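/- Let f : [0,1] → ℝ be continuous and set F(t) = ∫₀ᵗ f(s) ds. Then sup { ∫₀¹ ψ(t) f(t) dt : ψ : ℝ → ℝ infinitely differentiable with compact support contained in (0,1) and ∫₀¹ ψ′(t)² dt ≤ 1 } = ( ∫₀¹ F(t)² dt − (∫₀¹ F(t) dt)² )^{1/2}. (This evaluates the H^{−1}((0,1)) norm of f.) -/

import Mathlib

open MeasureTheory intervalIntegral

open Filter Topology

/-- A smooth mean-zero function supported in `[a, b] ⊆ (0, 1)` has a smooth primitive
compactly supported in `(0, 1)`. -/
lemma exists_primitive_tsupport_subset_Ioo {φ : ℝ → ℝ} (hφ : ContDiff ℝ (⊤ : ℕ∞) φ) {a b : ℝ}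
    (ha : 0 < a) (hb : b < 1) (hsupp : Function.support φ ⊆ Set.Icc a b)
    (hint : ∫ t in (0:ℝ)..1, φ t = 0) :
    ∃ ψ : ℝ → ℝ, ContDiff ℝ (⊤ : ℕ∞) ψ ∧ HasCompactSupport ψ ∧ tsupport ψ ⊆ Set.Ioo 0 1 ∧
      deriv ψ = φ := by
  have hc : Continuous φ := hφ.continuous
  have hzero : ∀ x, x ∉ Set.Icc a b → φ x = 0 := fun x hx => by
    by_contra h
    exact hx (hsupp h)
  have hder : ∀ t, HasDerivAt (fun t => ∫ s in (0:ℝ)..t, φ s) (φ t) t := fun t =>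
    hc.integral_hasStrictDerivAt 0 t |>.hasDerivAt
  have hderiv : deriv (fun t => ∫ s in (0:ℝ)..t, φ s) = φ := funext fun t => (hder t).deriv
  have hts : tsupport (fun t => ∫ s in (0:ℝ)..t, φ s) ⊆ Set.Icc a b := by
    refine closure_minimal (fun t ht => ?_) isClosed_Icc
    by_contra hmem
    apply ht
    rcases lt_or_ge t a with hta | hta
    · refine (integral_congr fun s hs => ?_).trans integral_zero
      refine hzero s fun hs' => ?_
      have := hs.2.trans_lt (max_lt ha hta)
      exact absurd hs'.1 (not_le.mpr this)
    · have htb : b < t := by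
        by_contra h
        exact hmem ⟨hta, not_lt.mp h⟩
      have hsplit := integral_add_adjacent_intervals (hc.intervalIntegrable (μ := volume) 0 1)
        (hc.intervalIntegrable 1 t)
      have htail : ∫ s in (1:ℝ)..t, φ s = 0 := by
        refine (integral_congr fun s hs => ?_).trans integral_zero
        refine hzero s fun hs' => ?_
        have := (lt_min hb htb).trans_le hs.1
        exact absurd hs'.2 (not_le.mpr this)
      simp only
      rw [← hsplit, hint, htail, add_zero]
  refine ⟨fun t => ∫ s in (0:ℝ)..t, φ s, ?_, ?_, ?_, hderiv⟩
  · refine contDiff_infty_iff_deriv.mpr ⟨fun t => (hder t).differentiableAt, ?_⟩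
    rw [hderiv]
    exact hφ
  · exact isCompact_Icc.of_isClosed_subset (isClosed_tsupport _) hts
  · exact hts.trans fun x hx => ⟨ha.trans_le hx.1, hx.2.trans_lt hb⟩

/-- Bounded convergence on `[0, 1]` for continuous functions. -/
lemma tendsto_integral_zero_one_of_bounded {g : ℕ → ℝ → ℝ} {G : ℝ → ℝ} {B : ℝ}
    (hg : ∀ n, Continuous (g n)) (hB : ∀ n, ∀ x ∈ Set.Icc (0:ℝ) 1, |g n x| ≤ B)
    (hlim : ∀ x ∈ Set.Ioo (0:ℝ) 1, Tendsto (fun n => g n x) atTop (𝓝 (G x))) :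
    Tendsto (fun n => ∫ t in (0:ℝ)..1, g n t) atTop (𝓝 (∫ t in (0:ℝ)..1, G t)) := by
  refine intervalIntegral.tendsto_integral_filter_of_dominated_convergence (fun _ => B) ?_ ?_ ?_ ?_
  · exact Eventually.of_forall fun n => (hg n).aestronglyMeasurable
  · refine Eventually.of_forall fun n => Eventually.of_forall fun x hx => ?_
    rw [Set.uIoc_of_le zero_le_one] at hx
    exact hB n x ⟨hx.1.le, hx.2⟩
  · exact intervalIntegrable_const
  · filter_upwards [Measure.ae_ne volume (1:ℝ)] with x hx1 hx
    rw [Set.uIoc_of_le zero_le_one] at hx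
    exact hlim x ⟨hx.1, lt_of_le_of_ne hx.2 hx1⟩

/-- A continuous function is a boundedly pointwise limit on `(0, 1)` of smooth functions
compactly supported in `(0, 1)`. -/
lemma exists_smooth_support_bounded_tendsto {G : ℝ → ℝ} (hG : Continuous G) :
    ∃ (g : ℕ → ℝ → ℝ) (B : ℝ), (∀ n, ContDiff ℝ (⊤ : ℕ∞) (g n)) ∧
      (∀ n, ∃ a b : ℝ, 0 < a ∧ b < 1 ∧ Function.support (g n) ⊆ Set.Icc a b) ∧
      (∀ n, ∀ x ∈ Set.Icc (0:ℝ) 1, |g n x| ≤ B) ∧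
      ∀ x ∈ Set.Ioo (0:ℝ) 1, Tendsto (fun n => g n x) atTop (𝓝 (G x)) := by
  have hpos : ∀ n : ℕ, (0:ℝ) < 1 / ((n:ℝ) + 1) := fun n => Nat.one_div_pos_of_nat
  choose p hp using fun n : ℕ =>
    exists_polynomial_near_of_continuousOn 0 1 G hG.continuousOn (1 / ((n:ℝ) + 1)) (hpos n)
  obtain ⟨M, hM⟩ := isCompact_Icc.exists_bound_of_continuousOn
    (hG.continuousOn (s := Set.Icc (0:ℝ) 1))
  let χ : ℕ → ContDiffBump (1 / 2 : ℝ) := fun n =>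
    { rIn := 1 / 2 - 1 / ((n:ℝ) + 3)
      rOut := 1 / 2 - 1 / ((n:ℝ) + 4)
      rIn_pos := by
        have : 1 / ((n:ℝ) + 3) < 1 / 2 := by
          apply one_div_lt_one_div_of_lt <;> linarith [Nat.cast_nonneg (α := ℝ) n]
        linarith
      rIn_lt_rOut := by
        have : 1 / ((n:ℝ) + 4) < 1 / ((n:ℝ) + 3) := by
          apply one_div_lt_one_div_of_lt <;> linarith [Nat.cast_nonneg (α := ℝ) n]
        linarith }
  refine ⟨fun n x => χ n x * (p n).eval x, M + 1, fun n => ?_, fun n => ?_, fun n x hx => ?_,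
    fun x hx => ?_⟩
  · exact (χ n).contDiff.mul (by simpa using (p n).contDiff_aeval (𝕜 := ℝ) (⊤ : ℕ∞))
  · have h4 : (0:ℝ) < 1 / ((n:ℝ) + 4) := by positivity
    refine ⟨1 / ((n:ℝ) + 4), 1 - 1 / ((n:ℝ) + 4), h4, by linarith, fun x hx => ?_⟩
    have hx' : x ∈ Function.support (χ n) := left_ne_zero_of_mul hx
    rw [(χ n).support_eq, Metric.mem_ball, Real.dist_eq, abs_lt] at hx'
    have hr : (χ n).rOut = 1 / 2 - 1 / ((n:ℝ) + 4) := rfl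
    rw [hr] at hx'
    constructor <;> linarith [hx'.1, hx'.2]
  · have h1 : |(p n).eval x| ≤ M + 1 := by
      have hn : 1 / ((n:ℝ) + 1) ≤ 1 := by
        rw [div_le_one (by positivity)]
        linarith [Nat.cast_nonneg (α := ℝ) n]
      have hGx : |G x| ≤ M := hM x hx
      have := abs_add_le ((p n).eval x - G x) (G x)
      rw [sub_add_cancel] at this
      linarith [hp n x hx]
    rw [abs_mul, abs_of_nonneg (χ n).nonneg]
    exact (mul_le_of_le_one_left (abs_nonneg _) (χ n).le_one).trans h1
  · have hpx : Tendsto (fun n => (p n).eval x) atTop (𝓝 (G x)) := by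
      rw [tendsto_iff_dist_tendsto_zero]
      exact squeeze_zero (fun _ => dist_nonneg)
        (fun n => (hp n x ⟨hx.1.le, hx.2.le⟩).le) tendsto_one_div_add_atTop_nhds_zero_nat
    refine hpx.congr' ?_
    have hsmall : Tendsto (fun n : ℕ => 1 / ((n:ℝ) + 3)) atTop (𝓝 0) := by
      have := (tendsto_add_atTop_iff_nat 2).mpr (tendsto_one_div_add_atTop_nhds_zero_nat (𝕜 := ℝ))
      refine this.congr fun n => ?_
      push_cast
      ring_nf
    filter_upwards [hsmall.eventually (gt_mem_nhds hx.1),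
      hsmall.eventually (gt_mem_nhds (sub_pos.mpr hx.2))] with n hn0 hn1
    have : χ n x = 1 := by
      apply (χ n).one_of_mem_closedBall
      have hr : (χ n).rIn = 1 / 2 - 1 / ((n:ℝ) + 3) := rfl
      rw [Metric.mem_closedBall, Real.dist_eq, abs_le, hr]
      constructor <;> linarith
    rw [this, one_mul]

/-- There is a smooth function of integral one supported in the interior of `[0, 1]`. -/
lemma exists_smooth_support_integral_eq_one :
    ∃ ρ : ℝ → ℝ, ContDiff ℝ (⊤ : ℕ∞) ρ ∧
      Function.support ρ ⊆ Set.Icc (1 / 4 : ℝ) (3 / 4) ∧ ∫ t in (0:ℝ)..1, ρ t = 1 := by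
  let χ : ContDiffBump (1 / 2 : ℝ) := ⟨1 / 8, 1 / 4, by norm_num, by norm_num⟩
  have hsupp : Function.support (χ.normed volume) ⊆ Set.Icc (1 / 4 : ℝ) (3 / 4) := by
    rw [χ.support_normed_eq, Real.ball_eq_Ioo]
    refine Set.Ioo_subset_Icc_self.trans (Set.Icc_subset_Icc ?_ ?_) <;> norm_num [χ]
  refine ⟨χ.normed volume, χ.contDiff_normed, hsupp, ?_⟩
  rw [integral_eq_integral_of_support_subset, χ.integral_normed]
  exact hsupp.trans fun x hx => ⟨by linarith [hx.1], by linarith [hx.2]⟩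

/-- A continuous function of mean zero is a boundedly pointwise limit on `(0, 1)` of smooth
mean-zero functions compactly supported in `(0, 1)`. -/
lemma exists_smooth_mean_zero_bounded_tendsto {G : ℝ → ℝ} (hG : Continuous G)
    (hG0 : ∫ t in (0:ℝ)..1, G t = 0) :
    ∃ (g : ℕ → ℝ → ℝ) (B : ℝ), (∀ n, ContDiff ℝ (⊤ : ℕ∞) (g n)) ∧
      (∀ n, ∃ a b : ℝ, 0 < a ∧ b < 1 ∧ Function.support (g n) ⊆ Set.Icc a b) ∧
      (∀ n, ∫ t in (0:ℝ)..1, g n t = 0) ∧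
      (∀ n, ∀ x ∈ Set.Icc (0:ℝ) 1, |g n x| ≤ B) ∧
      ∀ x ∈ Set.Ioo (0:ℝ) 1, Tendsto (fun n => g n x) atTop (𝓝 (G x)) := by
  obtain ⟨g, B, hg, hsupp, hB, hlim⟩ := exists_smooth_support_bounded_tendsto hG
  obtain ⟨ρ, hρ, hρsupp, hρint⟩ := exists_smooth_support_integral_eq_one
  obtain ⟨R, hR⟩ := isCompact_Icc.exists_bound_of_continuousOn
    (hρ.continuous.continuousOn (s := Set.Icc (0:ℝ) 1))
  have hc : Tendsto (fun n => ∫ t in (0:ℝ)..1, g n t) atTop (𝓝 0) := by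
    have := tendsto_integral_zero_one_of_bounded (fun n => (hg n).continuous) hB hlim
    rwa [hG0] at this
  have hcB : ∀ n, |∫ t in (0:ℝ)..1, g n t| ≤ B := fun n => by
    have := norm_integral_le_of_norm_le_const (a := (0:ℝ)) (b := 1) (f := g n) (C := B)
      fun x hx => by
        rw [Set.uIoc_of_le zero_le_one] at hx
        exact hB n x ⟨hx.1.le, hx.2⟩
    simpa using this
  refine ⟨fun n x => g n x - (∫ t in (0:ℝ)..1, g n t) * ρ x, B + B * R, fun n => ?_, fun n => ?_,
    fun n => ?_, fun n x hx => ?_, fun x hx => ?_⟩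
  · exact (hg n).sub (contDiff_const.mul hρ)
  · obtain ⟨a, b, ha, hb, hab⟩ := hsupp n
    refine ⟨min a (1 / 4), max b (3 / 4), lt_min ha (by norm_num), max_lt hb (by norm_num),
      fun x hx => ?_⟩
    by_cases hgx : g n x = 0
    · have hρx : ρ x ≠ 0 := fun h => hx (by simp [hgx, h])
      have := hρsupp hρx
      exact ⟨(min_le_right _ _).trans this.1, this.2.trans (le_max_right _ _)⟩
    · have := hab hgx
      exact ⟨(min_le_left _ _).trans this.1, this.2.trans (le_max_left _ _)⟩
  · rw [integral_sub ((hg n).continuous.intervalIntegrable _ _)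
      ((hρ.continuous.const_mul _).intervalIntegrable _ _),
      intervalIntegral.integral_const_mul, hρint, mul_one, sub_self]
  · refine (abs_sub _ _).trans (add_le_add (hB n x hx) ?_)
    rw [abs_mul]
    exact mul_le_mul (hcB n) (hR x hx) (abs_nonneg _) ((abs_nonneg _).trans (hcB n))
  · simpa using (hlim x hx).sub (hc.mul_const (ρ x))

/-- Cauchy–Schwarz on `[0, 1]` for continuous functions. -/
lemma sq_integral_mul_le {u v : ℝ → ℝ} (hu : Continuous u) (hv : Continuous v) :
    (∫ t in (0:ℝ)..1, u t * v t) ^ 2 ≤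
      (∫ t in (0:ℝ)..1, u t ^ 2) * ∫ t in (0:ℝ)..1, v t ^ 2 := by
  have hquad : ∀ x : ℝ, 0 ≤ (∫ t in (0:ℝ)..1, u t ^ 2) * (x * x) +
      (2 * ∫ t in (0:ℝ)..1, u t * v t) * x + ∫ t in (0:ℝ)..1, v t ^ 2 := fun x => by
    have hnonneg : 0 ≤ ∫ t in (0:ℝ)..1, (x * u t + v t) ^ 2 :=
      integral_nonneg zero_le_one fun t _ => sq_nonneg _
    have hexp : ∫ t in (0:ℝ)..1, (x * u t + v t) ^ 2 = ∫ t in (0:ℝ)..1,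
        ((x * x) * u t ^ 2 + (2 * x) * (u t * v t) + v t ^ 2) :=
      integral_congr fun t _ => by ring
    rw [hexp, integral_add (Continuous.intervalIntegrable (by fun_prop) _ _)
      (Continuous.intervalIntegrable (by fun_prop) _ _),
      integral_add (Continuous.intervalIntegrable (by fun_prop) _ _)
      (Continuous.intervalIntegrable (by fun_prop) _ _),
      intervalIntegral.integral_const_mul, intervalIntegral.integral_const_mul] at hnonneg
    linarith
  have := discrim_le_zero hquad
  rw [discrim] at this
  linarith

/-- Integration by parts against a primitive of `f`, shifted by an arbitrary constant. -/
lemma integral_mul_eq_neg_integral_deriv_mul {f ψ : ℝ → ℝ} (hf : Continuous f)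
    (hψ : ContDiff ℝ (⊤ : ℕ∞) ψ) (hsupp : tsupport ψ ⊆ Set.Ioo 0 1) (m : ℝ) :
    ∫ t in (0:ℝ)..1, ψ t * f t =
      -∫ t in (0:ℝ)..1, deriv ψ t * ((∫ s in (0:ℝ)..t, f s) - m) := by
  have h0 : ψ 0 = 0 := image_eq_zero_of_notMem_tsupport fun h => lt_irrefl _ (hsupp h).1
  have h1 : ψ 1 = 0 := image_eq_zero_of_notMem_tsupport fun h => lt_irrefl _ (hsupp h).2
  have hd : Differentiable ℝ ψ := (contDiff_infty_iff_deriv.mp hψ).1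
  have hd' : Continuous (deriv ψ) := (contDiff_infty_iff_deriv.mp hψ).2.continuous
  rw [integral_mul_deriv_eq_deriv_mul (fun x _ => (hd x).hasDerivAt)
    (fun x _ => (hf.integral_hasStrictDerivAt 0 x).hasDerivAt.sub_const m)
    (hd'.intervalIntegrable _ _) (hf.intervalIntegrable _ _), h0, h1]
  ring

/-- The evaluation of the negative Sobolev norm for a function continuous on the whole line. -/
lemma sSup_integral_mul_eq_sqrt_of_continuous {f : ℝ → ℝ} (hf : Continuous f) :
    sSup {r : ℝ | ∃ ψ : ℝ → ℝ, ContDiff ℝ (⊤ : ℕ∞) ψ ∧ HasCompactSupport ψ ∧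
        tsupport ψ ⊆ Set.Ioo 0 1 ∧ (∫ t in (0:ℝ)..1, (deriv ψ t) ^ 2) ≤ 1 ∧
        r = ∫ t in (0:ℝ)..1, ψ t * f t}
      = Real.sqrt ((∫ t in (0:ℝ)..1, (∫ s in (0:ℝ)..t, f s) ^ 2) -
          (∫ t in (0:ℝ)..1, ∫ s in (0:ℝ)..t, f s) ^ 2) := by
  set m : ℝ := ∫ t in (0:ℝ)..1, ∫ s in (0:ℝ)..t, f s with hm
  have hF : Continuous fun t => ∫ s in (0:ℝ)..t, f s :=
    continuous_iff_continuousAt.mpr fun t => (hf.integral_hasStrictDerivAt 0 t).hasDerivAt.continuousAt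
  set G : ℝ → ℝ := fun t => (∫ s in (0:ℝ)..t, f s) - m with hGdef
  have hG : Continuous G := hF.sub continuous_const
  have hV : (∫ t in (0:ℝ)..1, (∫ s in (0:ℝ)..t, f s) ^ 2) - m ^ 2 =
      ∫ t in (0:ℝ)..1, G t ^ 2 := by
    have hexp : ∫ t in (0:ℝ)..1, G t ^ 2 = ∫ t in (0:ℝ)..1,
        ((∫ s in (0:ℝ)..t, f s) ^ 2 - (2 * m) * (∫ s in (0:ℝ)..t, f s) + m ^ 2) :=
      integral_congr fun t _ => by simp only [hGdef]; ring
    rw [hexp, integral_add (Continuous.intervalIntegrable (by fun_prop) _ _)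
      intervalIntegrable_const, integral_sub (Continuous.intervalIntegrable (by fun_prop) _ _)
      ((hF.const_mul _).intervalIntegrable _ _), intervalIntegral.integral_const_mul, ← hm]
    simp
    ring
  have hG0 : ∫ t in (0:ℝ)..1, -G t = 0 := by
    rw [intervalIntegral.integral_neg, hGdef, integral_sub (hF.intervalIntegrable _ _)
      intervalIntegrable_const, ← hm]
    simp
  rw [hV]
  set V : ℝ := ∫ t in (0:ℝ)..1, G t ^ 2
  have hV0 : 0 ≤ V := integral_nonneg zero_le_one fun t _ => sq_nonneg _
  have hzero_mem : ∃ ψ : ℝ → ℝ, ContDiff ℝ (⊤ : ℕ∞) ψ ∧ HasCompactSupport ψ ∧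
        tsupport ψ ⊆ Set.Ioo 0 1 ∧ (∫ t in (0:ℝ)..1, (deriv ψ t) ^ 2) ≤ 1 ∧
        (0:ℝ) = ∫ t in (0:ℝ)..1, ψ t * f t :=
    ⟨fun _ => 0, contDiff_const, HasCompactSupport.zero, by simp [tsupport], by simp, by simp⟩
  refine csSup_eq_of_forall_le_of_forall_lt_exists_gt ⟨0, hzero_mem⟩ ?_ ?_
  · rintro r ⟨ψ, hψ, -, hsupp, hle, rfl⟩
    have hd' : Continuous (deriv ψ) := (contDiff_infty_iff_deriv.mp hψ).2.continuous
    rw [integral_mul_eq_neg_integral_deriv_mul hf hψ hsupp m]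
    refine Real.le_sqrt_of_sq_le ?_
    rw [neg_sq]
    exact (sq_integral_mul_le hd' hG).trans (mul_le_of_le_one_left hV0 hle)
  · intro w hw
    rcases hV0.eq_or_lt with hVz | hVpos
    · exact ⟨0, hzero_mem, by rwa [← hVz, Real.sqrt_zero] at hw⟩
    obtain ⟨φ, B, hφ, hsupp, hmean, hB, hlim⟩ :=
      exists_smooth_mean_zero_bounded_tendsto hG.neg hG0
    have hsq : Tendsto (fun n => ∫ t in (0:ℝ)..1, φ n t ^ 2) atTop (𝓝 V) := by
      refine tendsto_integral_zero_one_of_bounded (B := B ^ 2) (fun n => (hφ n).continuous.pow 2)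
        (fun n x hx => ?_) fun x hx => ?_
      · rw [abs_pow]
        exact pow_le_pow_left₀ (abs_nonneg _) (hB n x hx) 2
      · simpa using (hlim x hx).pow 2
    have hpair : Tendsto (fun n => ∫ t in (0:ℝ)..1, φ n t * G t) atTop (𝓝 (-V)) := by
      obtain ⟨M, hM⟩ := isCompact_Icc.exists_bound_of_continuousOn
        (hG.continuousOn (s := Set.Icc (0:ℝ) 1))
      rw [← intervalIntegral.integral_neg]
      refine tendsto_integral_zero_one_of_bounded (B := B * M)
        (fun n => (hφ n).continuous.mul hG) (fun n x hx => ?_) fun x hx => ?_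
      · rw [abs_mul]
        exact mul_le_mul (hB n x hx) (hM x hx) (abs_nonneg _)
          ((abs_nonneg _).trans (hB n x hx))
      · have := (hlim x hx).mul_const (G x)
        rwa [Pi.neg_apply, neg_mul, ← sq] at this
    have hratio : Tendsto (fun n => (√(∫ t in (0:ℝ)..1, φ n t ^ 2))⁻¹ *
        -∫ t in (0:ℝ)..1, φ n t * G t) atTop (𝓝 √V) := by
      have := (hsq.sqrt.inv₀ (Real.sqrt_pos.mpr hVpos).ne').mul hpair.neg
      rwa [neg_neg, inv_mul_eq_div, Real.div_sqrt] at this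
    obtain ⟨n, hn, hnpos⟩ :=
      ((hratio.eventually (lt_mem_nhds hw)).and (hsq.eventually (lt_mem_nhds hVpos))).exists
    obtain ⟨a, b, ha, hb, hab⟩ := hsupp n
    obtain ⟨ψ, hψ, hψc, hψs, hψd⟩ :=
      exists_primitive_tsupport_subset_Ioo (hφ n) ha hb hab (hmean n)
    set c : ℝ := (√(∫ t in (0:ℝ)..1, φ n t ^ 2))⁻¹ with hc
    refine ⟨_, ⟨fun t => c * ψ t, contDiff_const.mul hψ, hψc.mul_left,
      (tsupport_mul_subset_right).trans hψs, ?_, rfl⟩, ?_⟩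
    · have hderiv : ∀ t, deriv (fun t => c * ψ t) t = c * φ n t := fun t => by
        rw [deriv_const_mul_field, hψd]
      simp only [hderiv, mul_pow, intervalIntegral.integral_const_mul]
      rw [hc, inv_pow, Real.sq_sqrt hnpos.le, inv_mul_cancel₀ hnpos.ne']
    · simp only [mul_assoc, intervalIntegral.integral_const_mul]
      rwa [integral_mul_eq_neg_integral_deriv_mul hf hψ hψs m, hψd]

/-- The `H^{−1}((0,1))` norm of a continuous `f`: the supremum of `∫₀¹ ψ f` over smooth
`ψ` with compact support in `(0,1)` and `∫₀¹ (ψ′)² ≤ 1` equals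
`(∫₀¹ F² − (∫₀¹ F)²)^{1/2}` where `F(t) = ∫₀ᵗ f`. -/
theorem stmt_8 (f : ℝ → ℝ) (hf : ContinuousOn f (Set.Icc 0 1)) :
    sSup {r : ℝ | ∃ ψ : ℝ → ℝ, ContDiff ℝ (⊤ : ℕ∞) ψ ∧ HasCompactSupport ψ ∧
        tsupport ψ ⊆ Set.Ioo 0 1 ∧ (∫ t in (0:ℝ)..1, (deriv ψ t) ^ 2) ≤ 1 ∧
        r = ∫ t in (0:ℝ)..1, ψ t * f t}
      = Real.sqrt ((∫ t in (0:ℝ)..1, (∫ s in (0:ℝ)..t, f s) ^ 2) -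
          (∫ t in (0:ℝ)..1, ∫ s in (0:ℝ)..t, f s) ^ 2) := by
  obtain ⟨g, hg, hgf⟩ : ∃ g : ℝ → ℝ, Continuous g ∧ Set.EqOn f g (Set.Icc 0 1) :=
    ⟨Set.IccExtend zero_le_one ((Set.Icc (0:ℝ) 1).domRestrict f),
      hf.domRestrict.Icc_extend', fun x hx => (Set.IccExtend_of_mem zero_le_one ((Set.Icc (0:ℝ) 1).domRestrict f) hx).symm⟩
  have hprim : ∀ t ∈ Set.Icc (0:ℝ) 1, ∫ s in (0:ℝ)..t, f s = ∫ s in (0:ℝ)..t, g s :=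
    fun t ht => integral_congr fun s hs => by
      rw [Set.uIcc_of_le ht.1] at hs
      exact hgf ⟨hs.1, hs.2.trans ht.2⟩
  have hpair : ∀ ψ : ℝ → ℝ, ∫ t in (0:ℝ)..1, ψ t * f t = ∫ t in (0:ℝ)..1, ψ t * g t :=
    fun ψ => integral_congr fun t ht => by
      rw [Set.uIcc_of_le zero_le_one] at ht
      simp only [hgf ht]
  have hmean : ∫ t in (0:ℝ)..1, ∫ s in (0:ℝ)..t, f s = ∫ t in (0:ℝ)..1, ∫ s in (0:ℝ)..t, g s :=
    integral_congr fun t ht => by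
      rw [Set.uIcc_of_le zero_le_one] at ht
      exact hprim t ht
  have hsq : ∫ t in (0:ℝ)..1, (∫ s in (0:ℝ)..t, f s) ^ 2 =
      ∫ t in (0:ℝ)..1, (∫ s in (0:ℝ)..t, g s) ^ 2 :=
    integral_congr fun t ht => by
      rw [Set.uIcc_of_le zero_le_one] at ht
      simp only [hprim t ht]
  simp only [hpair, hmean, hsq]
  exact sSup_integral_mul_eq_sqrt_of_continuous hg
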